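/- arXiv:2601.02142 — 2 statements merged into one kernel-verified Lean document; each statement's English description precedes it below -/
import Mathlib

section
/- Let 0 < α < 1, λ > 0, and γ > 0 (exponential aging case ψ(t) = e^{γt}). Then the memory kernel 𝒦(t) := (e^{γt})^{α−1} E_{α,α}(−λ (e^{γt})^α) decays exponentially fast: lim_{t → ∞} e^{(1+α)γt} · 𝒦(t) = −1/(λ² Γ(−α)), and in particular 𝒦(t) = O(e^{−(1+α)γt}) as t → ∞. Hence rapid (exponential) aging transforms the hereditary power-law memory into short-range exponential relaxation (the Amnesia Phenomenon). -/
open MeasureTheory Set Filter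

noncomputable section

/-- The two-parameter Mittag-Leffler function (real argument). -/
def mlE (α β x : ℝ) : ℝ := ∑' k : ℕ, x ^ k / Real.Gamma (α * k + β)

open scoped Topology Real
open Complex (I)

lemma integrable_exp_mul_exp_neg_exp {s : ℝ} (hs : 0 < s) :
    Integrable fun u : ℝ => Real.exp (s * u) * Real.exp (-Real.exp u) := by
  have h := integrableOn_image_iff_integrableOn_abs_deriv_smul (s := univ) (f := Real.exp)
    (f' := Real.exp) MeasurableSet.univ (fun x _ => (Real.hasDerivAt_exp x).hasDerivWithinAt)
    Real.exp_injective.injOn (fun x : ℝ => Real.exp (-x) * x ^ (s - 1))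
  rw [image_univ, Real.range_exp, integrableOn_univ] at h
  refine (h.1 (Real.GammaIntegral_convergent hs)).congr (ae_of_all _ fun u => ?_)
  simp only [abs_of_pos (Real.exp_pos u), smul_eq_mul, ← Real.exp_mul, ← Real.exp_add]
  congr 1
  ring

lemma integral_exp_mul_exp_neg_exp {s : ℝ} (hs : 0 < s) :
    ∫ u : ℝ, Real.exp (s * u) * Real.exp (-Real.exp u) = Real.Gamma s := by
  have h := integral_image_eq_integral_abs_deriv_smul (s := univ) (f := Real.exp)
    (f' := Real.exp) MeasurableSet.univ (fun x _ => (Real.hasDerivAt_exp x).hasDerivWithinAt)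
    Real.exp_injective.injOn (fun x : ℝ => Real.exp (-x) * x ^ (s - 1))
  rw [image_univ, Real.range_exp, setIntegral_univ, ← Real.Gamma_eq_integral hs] at h
  rw [h]
  refine integral_congr_ae (ae_of_all _ fun u => ?_)
  simp only [abs_of_pos (Real.exp_pos u), smul_eq_mul, ← Real.exp_mul, ← Real.exp_add]
  congr 1
  ring

lemma integrableOn_Ioi_exp_mul_exp_neg_exp (s b : ℝ) :
    IntegrableOn (fun u : ℝ => Real.exp (s * u) * Real.exp (-Real.exp u)) (Ioi b) := by
  have h : 0 < |s| + 1 := by positivity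
  refine ((integrable_exp_mul_exp_neg_exp h).integrableOn.const_mul
    (Real.exp (-(|s| + 1 - s) * b))).mono' (by fun_prop) ?_
  refine (ae_restrict_iff' measurableSet_Ioi).2 (ae_of_all _ fun u hu => ?_)
  rw [Real.norm_of_nonneg (by positivity), ← Real.exp_add, ← Real.exp_add, ← Real.exp_add,
    Real.exp_le_exp]
  have := le_abs_self s
  nlinarith [mem_Ioi.1 hu]

/-- The integrand `e ^ ζ * f ζ` of a Hankel-type contour integral, pulled back along
`ζ = exp w`, with `φ w = f (exp w)`. -/
def hankelIntegrand (φ : ℂ → ℂ) (w : ℂ) : ℂ :=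
  Complex.exp (Complex.exp w) * Complex.exp w * φ w

/-- The difference of the values of `G` on the two edges of the strip `|Im w| ≤ π`. -/
def stripJump (G : ℂ → ℂ) (u : ℝ) : ℂ := G (u + (π : ℝ) * I) - G (u + (-π : ℝ) * I)

/-- The Hankel contour integral in logarithmic coordinates: an arc of radius `exp b` followed by
both sides of the cut along the negative axis. -/
def hankelIntegral (φ : ℂ → ℂ) (b : ℝ) : ℂ :=
  I * (∫ θ in (-π)..π, hankelIntegrand φ (b + θ * I)) +
    ∫ u in Ioi b, stripJump (hankelIntegrand φ) u

lemma exp_add_pi_mul_I (u : ℝ) : Complex.exp (u + (π : ℝ) * I) = -(Real.exp u : ℂ) := by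
  rw [Complex.exp_add, Complex.exp_pi_mul_I]; simp

lemma exp_add_neg_pi_mul_I (u : ℝ) : Complex.exp (u + (-π : ℝ) * I) = -(Real.exp u : ℂ) := by
  rw [Complex.exp_add, Complex.ofReal_neg, neg_mul, Complex.exp_neg, Complex.exp_pi_mul_I]
  norm_num

lemma stripJump_hankelIntegrand (φ : ℂ → ℂ) (u : ℝ) :
    stripJump (hankelIntegrand φ) u =
      -((Real.exp (1 * u) * Real.exp (-Real.exp u) : ℝ) : ℂ) * stripJump φ u := by
  simp only [stripJump, hankelIntegrand, exp_add_pi_mul_I, exp_add_neg_pi_mul_I, one_mul]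
  push_cast
  ring

lemma hankelIntegral_eq {φ : ℂ → ℂ} {c : ℂ} (b : ℝ)
    (hd : ∀ w : ℂ, |w.im| ≤ π → DifferentiableAt ℂ φ w)
    (hi : Integrable (stripJump (hankelIntegrand φ)))
    (hc : Tendsto (fun a : ℝ => ∫ θ in (-π)..π, hankelIntegrand φ (a + θ * I)) atBot (𝓝 c)) :
    hankelIntegral φ b = (∫ u, stripJump (hankelIntegrand φ) u) + I * c := by
  set G := hankelIntegrand φ with hG
  have hdG : ∀ w : ℂ, |w.im| ≤ π → DifferentiableAt ℂ G w := fun w hw => by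
    have := hd w hw
    unfold G hankelIntegrand
    fun_prop
  have hii : ∀ a ε : ℝ, |ε| = π → IntervalIntegrable (fun u : ℝ => G (u + ε * I)) volume a b := by
    intro a ε hε
    refine Continuous.intervalIntegrable ?_ _ _
    refine continuous_iff_continuousAt.2 fun u => ?_
    have h1 : ContinuousAt G (u + ε * I) := (hdG _ (by simp [hε])).continuousAt
    exact ContinuousAt.comp (f := fun u : ℝ => (u + ε * I : ℂ)) h1 (by fun_prop)
  have hrect : ∀ a : ℝ, I * (∫ θ in (-π)..π, G (b + θ * I)) =
      (∫ u in a..b, stripJump G u) + I * ∫ θ in (-π)..π, G (a + θ * I) := by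
    intro a
    have h := Complex.integral_boundary_rect_eq_zero_of_differentiableOn G
      (a + (-π : ℝ) * I) (b + (π : ℝ) * I) (fun w hw => by
        refine (hdG w ?_).differentiableWithinAt
        have h2 := hw.2
        simp only [mem_preimage, Complex.add_im, Complex.ofReal_im, Complex.im_ofReal_mul,
          Complex.I_im, mul_one, zero_add] at h2
        rw [uIcc_of_le (by linarith [Real.pi_pos])] at h2
        exact abs_le.2 h2)
    simp only [Complex.add_im, Complex.ofReal_im, Complex.im_ofReal_mul, Complex.I_im, mul_one,
      zero_add, Complex.add_re, Complex.ofReal_re, Complex.re_ofReal_mul, Complex.I_re, mul_zero,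
      add_zero, smul_eq_mul] at h
    unfold stripJump
    rw [intervalIntegral.integral_sub (hii a π (abs_of_pos Real.pi_pos))
      (hii a (-π) (by rw [abs_neg, abs_of_pos Real.pi_pos]))]
    linear_combination h
  have h1 : Tendsto (fun a : ℝ => (∫ u in a..b, stripJump G u) +
      I * ∫ θ in (-π)..π, G (a + θ * I)) atBot
      (𝓝 ((∫ u in Iic b, stripJump G u) + I * c)) :=
    (intervalIntegral_tendsto_integral_Iic b hi.integrableOn tendsto_id).add (hc.const_mul I)
  have h2 := tendsto_nhds_unique (tendsto_const_nhds.congr hrect) h1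
  rw [hankelIntegral, ← hG, h2,
    ← intervalIntegral.integral_Iic_add_Ioi hi.integrableOn hi.integrableOn]
  ring

lemma tendsto_arc_atBot {φ : ℂ → ℂ} {c : ℂ} {M : ℝ}
    (hd : ∀ w : ℂ, |w.im| ≤ π → DifferentiableAt ℂ φ w)
    (hM : ∀ᶠ a : ℝ in atBot, ∀ θ : ℝ, ‖Complex.exp (a + θ * I) * φ (a + θ * I)‖ ≤ M)
    (hl : ∀ θ : ℝ, Tendsto (fun a : ℝ => Complex.exp (a + θ * I) * φ (a + θ * I)) atBot (𝓝 c)) :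
    Tendsto (fun a : ℝ => ∫ θ in (-π)..π, hankelIntegrand φ (a + θ * I)) atBot
      (𝓝 (2 * π * c)) := by
  have h : Tendsto (fun a : ℝ => ∫ θ in (-π)..π, hankelIntegrand φ (a + θ * I)) atBot
      (𝓝 (∫ _ in (-π)..π, c)) := by
    have hle : -π ≤ π := by linarith [Real.pi_pos]
    refine intervalIntegral.tendsto_integral_filter_of_dominated_convergence
      (fun _ => Real.exp 1 * M) ?_ ?_ (by simp) ?_
    · refine Eventually.of_forall fun a => ?_
      rw [uIoc_of_le hle]
      refine ContinuousOn.aestronglyMeasurable (fun θ hθ => ?_) measurableSet_Ioc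
      have h1 : DifferentiableAt ℂ φ (a + θ * I) := hd _ (by
        simpa using abs_le.2 ⟨hθ.1.le, hθ.2⟩)
      have h2 : ContinuousAt (hankelIntegrand φ) (a + θ * I) := by
        have := h1.continuousAt
        unfold hankelIntegrand
        fun_prop
      exact (ContinuousAt.comp (f := fun θ : ℝ => (a + θ * I : ℂ)) h2
        (by fun_prop)).continuousWithinAt
    · filter_upwards [hM, Iic_mem_atBot 0] with a ha ha0
      refine ae_of_all _ fun θ _ => ?_
      rw [hankelIntegrand, mul_assoc, norm_mul]
      refine mul_le_mul ?_ (ha θ) (norm_nonneg _) (Real.exp_pos _).le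
      rw [Complex.norm_exp]
      gcongr
      refine (Complex.re_le_norm _).trans ?_
      rw [Complex.norm_exp]
      simpa using ha0
    · refine ae_of_all _ fun θ _ => ?_
      have h0 : Tendsto (fun a : ℝ => Complex.exp (a + θ * I)) atBot (𝓝 0) := by
        rw [tendsto_zero_iff_norm_tendsto_zero]
        simpa [Complex.norm_exp] using Real.tendsto_exp_atBot
      have h1 := (Complex.continuous_exp.tendsto 0).comp h0
      rw [Complex.exp_zero] at h1
      have := h1.mul (hl θ)
      rw [one_mul] at this
      exact this.congr fun a => by simp [hankelIntegrand, mul_assoc]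
  convert h using 2
  rw [intervalIntegral.integral_const, Complex.real_smul]
  push_cast
  ring

/-- The power `ζ ^ (-β)` in the logarithmic coordinate `ζ = exp w`. -/
def expPow (β : ℝ) (w : ℂ) : ℂ := Complex.exp (-β * w)

lemma differentiable_expPow (β : ℝ) : Differentiable ℂ (expPow β) := by
  unfold expPow
  fun_prop

lemma stripJump_expPow (β u : ℝ) :
    stripJump (expPow β) u = -(2 * I * Real.sin (π * β)) * Real.exp (-β * u) := by
  have h1 : expPow β (u + (π : ℝ) * I) =
      Real.exp (-β * u) * (Real.cos (π * β) - Real.sin (π * β) * I) := by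
    rw [expPow, mul_add, Complex.exp_add]
    push_cast
    rw [sub_eq_add_neg, ← neg_mul, ← Complex.sin_neg, ← Complex.cos_neg, ← Complex.exp_mul_I]
    congr 2
    ring
  have h2 : expPow β (u + (-π : ℝ) * I) =
      Real.exp (-β * u) * (Real.cos (π * β) + Real.sin (π * β) * I) := by
    rw [expPow, mul_add, Complex.exp_add]
    push_cast
    rw [← Complex.exp_mul_I]
    congr 2
    ring
  rw [stripJump, h1, h2]
  ring

lemma stripJump_hankelIntegrand_expPow (β u : ℝ) :
    stripJump (hankelIntegrand (expPow β)) u =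
      2 * I * Real.sin (π * β) *
        ((Real.exp ((1 - β) * u) * Real.exp (-Real.exp u) : ℝ) : ℂ) := by
  rw [stripJump_hankelIntegrand, stripJump_expPow]
  have : Real.exp ((1 - β) * u) = Real.exp (1 * u) * Real.exp (-β * u) := by
    rw [← Real.exp_add]; congr 1; ring
  rw [this]
  push_cast
  ring

lemma integrableOn_stripJump_expPow (β b : ℝ) :
    IntegrableOn (stripJump (hankelIntegrand (expPow β))) (Ioi b) := by
  rw [funext (stripJump_hankelIntegrand_expPow β)]
  exact (integrableOn_Ioi_exp_mul_exp_neg_exp (1 - β) b).ofReal.const_mul _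

lemma exp_mul_expPow (β a θ : ℝ) : Complex.exp (a + θ * I) * expPow β (a + θ * I) =
    Complex.exp ((1 - β : ℝ) * (a + θ * I)) := by
  rw [expPow, ← Complex.exp_add]
  congr 1
  push_cast
  ring

lemma hankelIntegral_expPow_of_lt_one {β : ℝ} (h0 : 0 < β) (h1 : β < 1) (b : ℝ) :
    hankelIntegral (expPow β) b = 2 * π * I / Real.Gamma β := by
  have hs : 0 < 1 - β := by linarith
  have hn : ∀ a θ : ℝ, ‖Complex.exp (a + θ * I) * expPow β (a + θ * I)‖ =
      Real.exp ((1 - β) * a) := fun a θ => by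
    rw [exp_mul_expPow, Complex.norm_exp]
    simp
  have hd : ∀ w : ℂ, |w.im| ≤ π → DifferentiableAt ℂ (expPow β) w :=
    fun w _ => differentiable_expPow β w
  have harc : Tendsto (fun a : ℝ => ∫ θ in (-π)..π, hankelIntegrand (expPow β) (a + θ * I)) atBot
      (𝓝 (2 * π * 0)) := by
    refine tendsto_arc_atBot (M := 1) hd ?_ fun θ => ?_
    · filter_upwards [Iic_mem_atBot 0] with a ha θ
      rw [hn, Real.exp_le_one_iff]
      exact mul_nonpos_of_nonneg_of_nonpos hs.le ha
    · rw [tendsto_zero_iff_norm_tendsto_zero]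
      simp only [hn]
      exact Real.tendsto_exp_atBot.comp (tendsto_id.const_mul_atBot hs)
  rw [hankelIntegral_eq b hd ?_ harc, funext (stripJump_hankelIntegrand_expPow β),
    integral_const_mul, integral_complex_ofReal, integral_exp_mul_exp_neg_exp hs]
  · have hsin : Real.sin (π * β) ≠ 0 := by
      refine (Real.sin_pos_of_pos_of_lt_pi (by positivity) ?_).ne'
      nlinarith [Real.pi_pos]
    have hr := Real.Gamma_mul_Gamma_one_sub β
    have hg := (Real.Gamma_pos_of_pos h0).ne'
    have hr' : Real.sin (π * β) * Real.Gamma (1 - β) = π / Real.Gamma β := by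
      rw [eq_div_iff hg]
      rw [eq_div_iff hsin] at hr
      linarith
    have hr2 := congrArg (fun x : ℝ => (x : ℂ)) hr'
    push_cast at hr2 ⊢
    linear_combination 2 * I * hr2
  · rw [funext (stripJump_hankelIntegrand_expPow β)]
    exact (integrable_exp_mul_exp_neg_exp hs).ofReal.const_mul _

lemma hankelIntegral_expPow_one (b : ℝ) : hankelIntegral (expPow 1) b = 2 * π * I := by
  have hd : ∀ w : ℂ, |w.im| ≤ π → DifferentiableAt ℂ (expPow 1) w :=
    fun w _ => differentiable_expPow 1 w
  have h1 : ∀ a θ : ℝ, Complex.exp (a + θ * I) * expPow 1 (a + θ * I) = 1 := fun a θ => by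
    rw [exp_mul_expPow]; simp
  have harc : Tendsto (fun a : ℝ => ∫ θ in (-π)..π, hankelIntegrand (expPow 1) (a + θ * I)) atBot
      (𝓝 (2 * π * 1)) := by
    refine tendsto_arc_atBot (M := 1) hd (Eventually.of_forall fun a θ => ?_) fun θ => ?_
    · simp [h1]
    · simp [h1]
  have hz : stripJump (hankelIntegrand (expPow 1)) = fun _ => 0 := by
    funext u
    simp [stripJump_hankelIntegrand_expPow]
  rw [hankelIntegral_eq b hd (by simp [hz]) harc, hz]
  simp
  ring

lemma continuous_hankelIntegrand_expPow (β : ℝ) : Continuous (hankelIntegrand (expPow β)) := by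
  unfold hankelIntegrand expPow
  fun_prop

lemma hankelIntegral_expPow_add_one (β b : ℝ) :
    hankelIntegral (expPow β) b = β * hankelIntegral (expPow (β + 1)) b := by
  set P : ℂ → ℂ := fun w => Complex.exp (Complex.exp w) * expPow β w with hP
  have hdP : ∀ w, HasDerivAt P
      (hankelIntegrand (expPow β) w - β * hankelIntegrand (expPow (β + 1)) w) w := by
    intro w
    have h1 : HasDerivAt (fun w => Complex.exp (Complex.exp w))
        (Complex.exp (Complex.exp w) * Complex.exp w) w := (Complex.hasDerivAt_exp w).cexp
    have h2 : HasDerivAt (expPow β) (Complex.exp (-β * w) * (-β * 1)) w :=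
      ((hasDerivAt_id w).const_mul (-β : ℂ)).cexp
    refine (h1.mul h2).congr_deriv ?_
    have h3 : Complex.exp w * expPow (β + 1) w = expPow β w := by
      rw [expPow, expPow, ← Complex.exp_add]
      congr 1
      push_cast
      ring
    rw [show Complex.exp (-β * w) = expPow β w from rfl]
    simp only [hankelIntegrand]
    linear_combination (β * Complex.exp (Complex.exp w)) * h3
  have hc := continuous_hankelIntegrand_expPow β
  have hc' := continuous_hankelIntegrand_expPow (β + 1)
  have harc : I * ((∫ θ in (-π)..π, hankelIntegrand (expPow β) (b + θ * I)) -
      β * ∫ θ in (-π)..π, hankelIntegrand (expPow (β + 1)) (b + θ * I)) = stripJump P b := by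
    rw [← intervalIntegral.integral_const_mul, ← intervalIntegral.integral_sub,
      ← intervalIntegral.integral_const_mul]
    · rw [intervalIntegral.integral_eq_sub_of_hasDerivAt (f := fun θ : ℝ => P (b + θ * I))]
      · rfl
      · intro θ _
        have h1 : HasDerivAt (fun θ : ℝ => (b + θ * I : ℂ)) (1 * I) θ :=
          (Complex.ofRealCLM.hasDerivAt.mul_const I).const_add (b : ℂ)
        have := (hdP (b + θ * I)).comp θ h1
        exact this.congr_deriv (by ring)
      · refine Continuous.intervalIntegrable ?_ _ _
        fun_prop
    · refine Continuous.intervalIntegrable ?_ _ _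
      fun_prop
    · refine Continuous.intervalIntegrable ?_ _ _
      fun_prop
  have hi := integrableOn_stripJump_expPow β b
  have hi' := (integrableOn_stripJump_expPow (β + 1) b).const_mul (β : ℂ)
  have htail : (∫ u in Ioi b, stripJump (hankelIntegrand (expPow β)) u) -
      β * ∫ u in Ioi b, stripJump (hankelIntegrand (expPow (β + 1))) u = 0 - stripJump P b := by
    rw [← integral_const_mul, ← integral_sub hi hi']
    refine integral_Ioi_of_hasDerivAt_of_tendsto' (fun u _ => ?_) (hi.sub hi') ?_
    · have h1 : ∀ c : ℂ, HasDerivAt (fun u : ℝ => (u + c : ℂ)) 1 u := fun c =>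
        Complex.ofRealCLM.hasDerivAt.add_const c
      refine (((hdP _).comp u (h1 ((π : ℝ) * I))).sub
        ((hdP _).comp u (h1 ((-π : ℝ) * I)))).congr_deriv ?_
      simp only [stripJump]
      ring
    · have hPj : ∀ u : ℝ, stripJump P u = -(2 * I * Real.sin (π * β)) *
          ((Real.exp (-β * u) * Real.exp (-Real.exp u) : ℝ) : ℂ) := fun u => by
        have := stripJump_expPow β u
        simp only [stripJump, hP, exp_add_pi_mul_I, exp_add_neg_pi_mul_I] at this ⊢
        push_cast at this ⊢
        linear_combination Complex.exp (-Complex.exp u) * this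
      rw [funext hPj]
      have h0 : Tendsto (fun u : ℝ => Real.exp (-β * u) * Real.exp (-Real.exp u)) atTop (𝓝 0) := by
        have := (tendsto_rpow_mul_exp_neg_mul_atTop_nhds_zero (-β) 1 one_pos).comp
          Real.tendsto_exp_atTop
        refine this.congr fun u => ?_
        simp only [Function.comp_apply, ← Real.exp_mul, neg_one_mul, mul_comm u]
      have := ((Complex.continuous_ofReal.tendsto 0).comp h0).const_mul
        (-(2 * I * Real.sin (π * β)))
      simpa [Function.comp_def] using this
  simp only [hankelIntegral]
  linear_combination harc + htail

/-- Hankel's formula for the reciprocal of the Gamma function. -/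
lemma hankelIntegral_expPow {β : ℝ} (hβ : 0 < β) (b : ℝ) :
    hankelIntegral (expPow β) b = 2 * π * I / Real.Gamma β := by
  have key : ∀ n : ℕ, ∀ β : ℝ, 0 < β → β ≤ n + 1 →
      hankelIntegral (expPow β) b = 2 * π * I / Real.Gamma β := by
    intro n
    induction n with
    | zero =>
      intro β h0 h1
      rcases h1.lt_or_eq with h | h
      · exact hankelIntegral_expPow_of_lt_one h0 (by simpa using h) b
      · obtain rfl : β = 1 := by simpa using h
        simp [hankelIntegral_expPow_one]
    | succ n ih =>
      intro β h0 h1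
      rcases le_or_gt β 1 with h | h
      · exact ih β h0 (h.trans (by simp))
      · have hpos : 0 < β - 1 := by linarith
        have h2 := ih (β - 1) hpos (by push_cast at h1; linarith)
        rw [hankelIntegral_expPow_add_one, sub_add_cancel] at h2
        have h3 := Real.Gamma_add_one hpos.ne'
        rw [sub_add_cancel] at h3
        have hg : (Real.Gamma (β - 1) : ℂ) ≠ 0 := by
          exact_mod_cast (Real.Gamma_pos_of_pos hpos).ne'
        have hb : ((β - 1 : ℝ) : ℂ) ≠ 0 := by exact_mod_cast hpos.ne'
        rw [h3]
        rw [Complex.ofReal_mul]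
        rw [eq_div_iff hg] at h2
        rw [eq_div_iff (mul_ne_zero hb hg), ← h2]
        ring
  obtain ⟨n, hn⟩ := exists_nat_ge β
  exact key n β hβ (by linarith)

/-- The kernel `1 / (ζ ^ α + y)` in the logarithmic coordinate `ζ = exp w`. -/
def expResolvent (α y : ℝ) (w : ℂ) : ℂ := 1 / (Complex.exp (α * w) + y)

lemma exp_mul_add_ne_zero {α y : ℝ} (hα : 0 < α) (hα1 : α < 1) (hy : 0 < y) {w : ℂ}
    (hw : |w.im| ≤ π) : Complex.exp (α * w) + y ≠ 0 := by
  intro h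
  have him : |(α * w : ℂ).im| < π := by
    rw [Complex.im_ofReal_mul, abs_mul, abs_of_pos hα]
    nlinarith [Real.pi_pos]
  have h1 : Complex.exp (α * w) = ((-y : ℝ) : ℂ) := by
    push_cast
    linear_combination h
  have h2 := congrArg Complex.arg h1
  rw [Complex.arg_ofReal_of_neg (by linarith), ← Complex.log_im,
    Complex.log_exp (abs_lt.1 him).1 (abs_lt.1 him).2.le] at h2
  rw [h2, abs_of_pos Real.pi_pos] at him
  exact lt_irrefl _ him

lemma differentiableAt_expResolvent {α y : ℝ} (hα : 0 < α) (hα1 : α < 1) (hy : 0 < y) {w : ℂ}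
    (hw : |w.im| ≤ π) : DifferentiableAt ℂ (expResolvent α y) w := by
  have := exp_mul_add_ne_zero hα hα1 hy hw
  unfold expResolvent
  fun_prop (disch := assumption)

lemma sq_mul_sin_sq_le (α x y : ℝ) :
    y ^ 2 * Real.sin (π * α) ^ 2 ≤ x ^ 2 + 2 * x * y * Real.cos (π * α) + y ^ 2 := by
  nlinarith [sq_nonneg (x + y * Real.cos (π * α)), Real.sin_sq_add_cos_sq (π * α)]

lemma sin_pi_mul_pos {α : ℝ} (hα : 0 < α) (hα1 : α < 1) : 0 < Real.sin (π * α) := by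
  refine Real.sin_pos_of_pos_of_lt_pi (by positivity) ?_
  nlinarith [Real.pi_pos]

lemma stripJump_hankelIntegrand_expResolvent {α y : ℝ} (hα : 0 < α) (hα1 : α < 1) (hy : 0 < y)
    (u : ℝ) : stripJump (hankelIntegrand (expResolvent α y)) u =
      2 * I * Real.sin (π * α) *
        ((Real.exp ((1 + α) * u) * Real.exp (-Real.exp u) / (Real.exp (α * u) ^ 2 +
          2 * Real.exp (α * u) * y * Real.cos (π * α) + y ^ 2) : ℝ) : ℂ) := by
  have h1 : Complex.exp (α * (u + (π : ℝ) * I)) =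
      Real.exp (α * u) * (Real.cos (π * α) + Real.sin (π * α) * I) := by
    rw [mul_add, Complex.exp_add]
    push_cast
    rw [← Complex.exp_mul_I]
    congr 2
    ring
  have h2 : Complex.exp (α * (u + (-π : ℝ) * I)) =
      Real.exp (α * u) * (Real.cos (π * α) - Real.sin (π * α) * I) := by
    rw [mul_add, Complex.exp_add]
    push_cast
    rw [sub_eq_add_neg, ← neg_mul, ← Complex.sin_neg, ← Complex.cos_neg, ← Complex.exp_mul_I]
    congr 2
    ring
  have hn1 := exp_mul_add_ne_zero hα hα1 hy (w := u + (π : ℝ) * I)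
    (by simp [abs_of_pos Real.pi_pos])
  have hn2 := exp_mul_add_ne_zero hα hα1 hy (w := u + (-π : ℝ) * I)
    (by simp [abs_of_pos Real.pi_pos])
  have hN : 0 < Real.exp (α * u) ^ 2 + 2 * Real.exp (α * u) * y * Real.cos (π * α) + y ^ 2 :=
    lt_of_lt_of_le (by have := sin_pi_mul_pos hα hα1; positivity) (sq_mul_sin_sq_le α _ y)
  have hx : Real.exp ((1 + α) * u) = Real.exp (1 * u) * Real.exp (α * u) := by
    rw [← Real.exp_add]; congr 1; ring
  rw [stripJump_hankelIntegrand, stripJump, expResolvent, expResolvent, h1, h2, hx]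
  rw [h1] at hn1
  rw [h2] at hn2
  have hcs := congrArg (fun x : ℝ => (x : ℂ)) (Real.sin_sq_add_cos_sq (π * α))
  have hNC : ((Real.exp (α * u) ^ 2 + 2 * Real.exp (α * u) * y * Real.cos (π * α) + y ^ 2 : ℝ) : ℂ)
      ≠ 0 := by exact_mod_cast hN.ne'
  rw [Complex.ofReal_div]
  have hmul : ((Real.exp (α * u) ^ 2 + 2 * Real.exp (α * u) * y * Real.cos (π * α) + y ^ 2 : ℝ) : ℂ)
      = (Real.exp (α * u) * (Real.cos (π * α) + Real.sin (π * α) * I) + y) *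
        (Real.exp (α * u) * (Real.cos (π * α) - Real.sin (π * α) * I) + y) := by
    simp only [Complex.ofReal_add, Complex.ofReal_mul, Complex.ofReal_pow, Complex.ofReal_one,
      Complex.ofReal_ofNat] at hcs ⊢
    linear_combination (-(Real.exp (α * u) : ℂ) ^ 2) * hcs +
      ((Real.exp (α * u) : ℂ) ^ 2 * (Real.sin (π * α) : ℂ) ^ 2) * Complex.I_sq
  rw [hmul, div_sub_div _ _ hn1 hn2, mul_div_assoc', mul_div_assoc']
  congr 1
  push_cast
  ring

lemma integrable_div_quadratic {α y : ℝ} (hα : 0 < α) (hα1 : α < 1) (hy : 0 < y) :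
    Integrable fun u : ℝ => Real.exp ((1 + α) * u) * Real.exp (-Real.exp u) /
      (Real.exp (α * u) ^ 2 + 2 * Real.exp (α * u) * y * Real.cos (π * α) + y ^ 2) := by
  have hs := sin_pi_mul_pos hα hα1
  have h : 0 < 1 + α := by linarith
  have hm : Measurable fun u : ℝ => Real.exp ((1 + α) * u) * Real.exp (-Real.exp u) /
      (Real.exp (α * u) ^ 2 + 2 * Real.exp (α * u) * y * Real.cos (π * α) + y ^ 2) := by
    fun_prop
  refine ((integrable_exp_mul_exp_neg_exp h).div_const
    (y ^ 2 * Real.sin (π * α) ^ 2)).mono' hm.aestronglyMeasurable (ae_of_all _ fun u => ?_)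
  have hle := sq_mul_sin_sq_le α (Real.exp (α * u)) y
  have hpos : 0 < y ^ 2 * Real.sin (π * α) ^ 2 := by positivity
  rw [Real.norm_of_nonneg (div_nonneg (by positivity) (hpos.le.trans hle))]
  gcongr

lemma hankelIntegral_expResolvent {α y : ℝ} (hα : 0 < α) (hα1 : α < 1) (hy : 0 < y) (b : ℝ) :
    hankelIntegral (expResolvent α y) b = 2 * I * Real.sin (π * α) *
      ((∫ u : ℝ, Real.exp ((1 + α) * u) * Real.exp (-Real.exp u) / (Real.exp (α * u) ^ 2 +
          2 * Real.exp (α * u) * y * Real.cos (π * α) + y ^ 2) : ℝ) : ℂ) := by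
  have hd : ∀ w : ℂ, |w.im| ≤ π → DifferentiableAt ℂ (expResolvent α y) w :=
    fun w hw => differentiableAt_expResolvent hα hα1 hy hw
  have hsmall : ∀ᶠ a : ℝ in atBot, Real.exp (α * a) < y / 2 :=
    (Real.tendsto_exp_atBot.comp (tendsto_id.const_mul_atBot hα)).eventually_lt_const
      (by positivity)
  have hbd : ∀ᶠ a : ℝ in atBot, ∀ θ : ℝ,
      ‖Complex.exp (a + θ * I) * expResolvent α y (a + θ * I)‖ ≤ Real.exp a * (2 / y) := by
    filter_upwards [hsmall] with a ha θ
    rw [norm_mul, Complex.norm_exp, expResolvent, norm_div, norm_one]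
    have h1 : ‖Complex.exp (α * (a + θ * I))‖ = Real.exp (α * a) := by
      simp [Complex.norm_exp]
    have h2 : y / 2 ≤ ‖Complex.exp (α * (a + θ * I)) + y‖ := by
      have h3 := norm_sub_norm_le (y : ℂ) (-Complex.exp (α * (a + θ * I)))
      rw [norm_neg, h1, Complex.norm_of_nonneg hy.le, sub_neg_eq_add, add_comm (y : ℂ)] at h3
      linarith
    have h4 : (1 : ℝ) / ‖Complex.exp (α * (a + θ * I)) + y‖ ≤ 2 / y := by
      rw [← one_div_div y]
      exact one_div_le_one_div_of_le (by positivity) h2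
    have h5 : (a + θ * I : ℂ).re = a := by simp
    rw [h5]
    gcongr
  have harc : Tendsto
      (fun a : ℝ => ∫ θ in (-π)..π, hankelIntegrand (expResolvent α y) (a + θ * I)) atBot
      (𝓝 (2 * π * 0)) := by
    refine tendsto_arc_atBot (M := 1 * (2 / y)) hd ?_ fun θ => ?_
    · filter_upwards [hbd, Iic_mem_atBot 0] with a ha ha0 θ
      refine (ha θ).trans ?_
      gcongr
      exact Real.exp_le_one_iff.2 ha0
    · have h0 := Real.tendsto_exp_atBot.mul_const (2 / y)
      rw [zero_mul] at h0
      exact squeeze_zero_norm' (hbd.mono fun a ha => ha θ) h0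
  have hj := funext (stripJump_hankelIntegrand_expResolvent hα hα1 hy)
  rw [hankelIntegral_eq b hd ?_ harc, hj, integral_const_mul, integral_complex_ofReal]
  · simp
  · rw [hj]
    exact (integrable_div_quadratic hα hα1 hy).ofReal.const_mul _

lemma hasSum_expPow {α y b : ℝ} (hα : 0 < α) (hy : 0 < y) (hb : y * Real.exp (-α * b) < 1)
    {w : ℂ} (hw : b ≤ w.re) :
    HasSum (fun k : ℕ => (-y : ℂ) ^ k * expPow (α * k + α) w) (expResolvent α y w) := by
  have hn : ‖(-y : ℂ) * Complex.exp (-α * w)‖ < 1 := by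
    rw [norm_mul, norm_neg, Complex.norm_of_nonneg hy.le, Complex.norm_exp]
    refine lt_of_le_of_lt ?_ hb
    gcongr
    rw [← Complex.ofReal_neg, Complex.re_ofReal_mul]
    nlinarith
  have h := (hasSum_geometric_of_norm_lt_one hn).mul_left (Complex.exp (-α * w))
  convert! h using 1
  · funext k
    rw [mul_pow, ← Complex.exp_nat_mul, mul_left_comm, ← Complex.exp_add, expPow]
    congr 2
    push_cast
    ring
  · have h1 : Complex.exp (-α * w) * Complex.exp (α * w) = 1 := by
      rw [← Complex.exp_add]; simp
    have h2 : (1 : ℂ) - -y * Complex.exp (-α * w) =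
        Complex.exp (-α * w) * (Complex.exp (α * w) + y) := by
      linear_combination -h1
    rw [h2, mul_inv, ← mul_assoc, mul_inv_cancel₀ (Complex.exp_ne_zero _), one_mul, expResolvent,
      one_div]

lemma norm_hankelIntegrand_le (φ : ℂ → ℂ) (b θ : ℝ) :
    ‖hankelIntegrand φ (b + θ * I)‖ ≤
      Real.exp (Real.exp b) * Real.exp b * ‖φ (b + θ * I)‖ := by
  have h : ‖Complex.exp (b + θ * I)‖ = Real.exp b := by simp [Complex.norm_exp]
  rw [hankelIntegrand, norm_mul, norm_mul, h, Complex.norm_exp]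
  gcongr
  exact (Complex.re_le_norm _).trans h.le

lemma hasSum_hankelIntegral {α y b : ℝ} (hα : 0 < α) (hy : 0 < y)
    (hb : y * Real.exp (-α * b) < 1) :
    HasSum (fun k : ℕ => (-y : ℂ) ^ k * hankelIntegral (expPow (α * k + α)) b)
      (hankelIntegral (expResolvent α y) b) := by
  set q := y * Real.exp (-α * b) with hq
  have hq0 : 0 < q := by positivity
  have hgeo : Summable fun k : ℕ => q ^ k := summable_geometric_of_lt_one hq0.le hb
  have hG : ∀ w : ℂ, b ≤ w.re → HasSum
      (fun k : ℕ => (-y : ℂ) ^ k * hankelIntegrand (expPow (α * k + α)) w)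
      (hankelIntegrand (expResolvent α y) w) := fun w hw => by
    refine ((hasSum_expPow hα hy hb hw).mul_left
      (Complex.exp (Complex.exp w) * Complex.exp w)).congr_fun fun k => ?_
    rw [hankelIntegrand]
    ring
  have harc : HasSum (fun k : ℕ =>
      ∫ θ in (-π)..π, (-y : ℂ) ^ k * hankelIntegrand (expPow (α * k + α)) (b + θ * I))
      (∫ θ in (-π)..π, hankelIntegrand (expResolvent α y) (b + θ * I)) := by
    refine intervalIntegral.hasSum_integral_of_dominated_convergence
      (fun k _ => Real.exp (Real.exp b) * Real.exp b * Real.exp (-α * b) * q ^ k)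
      (fun k => ?_) (fun k => ae_of_all _ fun θ _ => ?_)
      (ae_of_all _ fun θ _ => hgeo.mul_left _) (by simp)
      (ae_of_all _ fun θ _ => hG _ (by simp))
    · have := continuous_hankelIntegrand_expPow (α * k + α)
      exact Continuous.aestronglyMeasurable (by fun_prop)
    · rw [norm_mul, norm_pow, norm_neg, Complex.norm_of_nonneg hy.le]
      refine (mul_le_mul_of_nonneg_left (norm_hankelIntegrand_le _ b θ) (by positivity)).trans
        (le_of_eq ?_)
      have h1 : ‖expPow (α * k + α) (b + θ * I)‖ =
          Real.exp (-α * b) * Real.exp (-α * b) ^ k := by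
        rw [expPow, Complex.norm_exp, ← Complex.ofReal_neg, Complex.re_ofReal_mul,
          ← Real.exp_nat_mul, ← Real.exp_add]
        congr 1
        simp
        ring
      rw [h1, hq, mul_pow]
      ring
  have htail : HasSum (fun k : ℕ =>
      ∫ u in Ioi b, (-y : ℂ) ^ k * stripJump (hankelIntegrand (expPow (α * k + α))) u)
      (∫ u in Ioi b, stripJump (hankelIntegrand (expResolvent α y)) u) := by
    refine MeasureTheory.hasSum_integral_of_dominated_convergence
      (fun k u => 2 * (Real.exp ((1 - α) * u) * Real.exp (-Real.exp u)) * q ^ k)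
      (fun k => ?_) (fun k => (ae_restrict_iff' measurableSet_Ioi).2 (ae_of_all _ fun u hu => ?_))
      (ae_of_all _ fun u => hgeo.mul_left _) ?_
      ((ae_restrict_iff' measurableSet_Ioi).2 (ae_of_all _ fun u hu => ?_))
    · exact ((integrableOn_stripJump_expPow (α * k + α) b).const_mul _).aestronglyMeasurable
    · have hu' : b ≤ u := (mem_Ioi.1 hu).le
      rw [stripJump_hankelIntegrand_expPow, norm_mul, norm_pow, norm_neg,
        Complex.norm_of_nonneg hy.le, norm_mul, norm_mul, norm_mul, Complex.norm_I,
        Complex.norm_real, Complex.norm_real, Complex.norm_ofNat, mul_one,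
        Real.norm_of_nonneg (r := _ * _) (by positivity)]
      have h1 : y ^ k * Real.exp ((1 - (α * k + α)) * u) ≤ Real.exp ((1 - α) * u) * q ^ k := by
        have h2 : Real.exp ((1 - (α * k + α)) * u) =
            Real.exp ((1 - α) * u) * Real.exp (-α * u) ^ k := by
          rw [← Real.exp_nat_mul, ← Real.exp_add]
          congr 1
          ring
        rw [h2, hq, mul_pow, mul_left_comm]
        gcongr ?_ * (_ * ?_ ^ k)
        exact Real.exp_le_exp.2 (by nlinarith)
      have h3 : ‖Real.sin (π * (α * k + α))‖ ≤ 1 := Real.abs_sin_le_one _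
      calc y ^ k * (2 * ‖Real.sin (π * (α * k + α))‖ *
            (Real.exp ((1 - (α * k + α)) * u) * Real.exp (-Real.exp u)))
          ≤ y ^ k * (2 * 1 *
            (Real.exp ((1 - (α * k + α)) * u) * Real.exp (-Real.exp u))) := by gcongr
        _ = 2 * (y ^ k * Real.exp ((1 - (α * k + α)) * u)) * Real.exp (-Real.exp u) := by ring
        _ ≤ 2 * (Real.exp ((1 - α) * u) * q ^ k) * Real.exp (-Real.exp u) := by gcongr
        _ = 2 * (Real.exp ((1 - α) * u) * Real.exp (-Real.exp u)) * q ^ k := by ring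
    · simp only [tsum_mul_left]
      exact ((integrableOn_Ioi_exp_mul_exp_neg_exp (1 - α) b).const_mul 2).mul_const _
    · have hu' : b ≤ u := (mem_Ioi.1 hu).le
      refine ((hG (u + (π : ℝ) * I) (by simpa using hu')).sub
        (hG (u + (-π : ℝ) * I) (by simpa using hu'))).congr_fun fun k => ?_
      rw [stripJump]
      ring
  refine ((harc.mul_left I).add htail).congr_fun fun k => ?_
  rw [intervalIntegral.integral_const_mul, integral_const_mul, hankelIntegral]
  ring

/-- The spectral representation of the Mittag-Leffler function on the negative axis. -/
lemma mlE_neg_eq_integral {α y : ℝ} (hα : 0 < α) (hα1 : α < 1) (hy : 0 < y) :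
    mlE α α (-y) = Real.sin (π * α) / π *
      ∫ u : ℝ, Real.exp ((1 + α) * u) * Real.exp (-Real.exp u) / (Real.exp (α * u) ^ 2 +
          2 * Real.exp (α * u) * y * Real.cos (π * α) + y ^ 2) := by
  have hlim : Tendsto (fun b : ℝ => y * Real.exp (-α * b)) atTop (𝓝 (y * 0)) :=
    (Real.tendsto_exp_atBot.comp (tendsto_id.const_mul_atTop_of_neg (by linarith))).const_mul y
  rw [mul_zero] at hlim
  obtain ⟨b, hb⟩ := (hlim.eventually_lt_const one_pos).exists
  have h := hasSum_hankelIntegral hα hy hb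
  rw [hankelIntegral_expResolvent hα hα1 hy] at h
  refine HasSum.tsum_eq ((Complex.hasSum_ofReal (f := fun k : ℕ =>
    (-y) ^ k / Real.Gamma (α * k + α))).1 ?_)
  have h2 := h.mul_left (1 / (2 * π * I))
  have hpi : (π : ℂ) ≠ 0 := by exact_mod_cast Real.pi_ne_zero
  convert! h2 using 1
  · funext k
    have hk : 0 < α * k + α := by positivity
    rw [hankelIntegral_expPow hk]
    have hg : (Real.Gamma (α * k + α) : ℂ) ≠ 0 := by
      exact_mod_cast (Real.Gamma_pos_of_pos hk).ne'
    push_cast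
    field_simp [Complex.I_ne_zero]
  · push_cast
    field_simp [Complex.I_ne_zero]

lemma tendsto_sq_mul_mlE_neg {α : ℝ} (hα : 0 < α) (hα1 : α < 1) :
    Tendsto (fun y : ℝ => y ^ 2 * mlE α α (-y)) atTop (𝓝 (-1 / Real.Gamma (-α))) := by
  have hs := sin_pi_mul_pos hα hα1
  have h1α : 0 < 1 + α := by linarith
  have hint : Tendsto (fun y : ℝ => ∫ u : ℝ, Real.exp ((1 + α) * u) * Real.exp (-Real.exp u) *
      (y ^ 2 / (Real.exp (α * u) ^ 2 + 2 * Real.exp (α * u) * y * Real.cos (π * α) + y ^ 2)))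
      atTop (𝓝 (∫ u : ℝ, Real.exp ((1 + α) * u) * Real.exp (-Real.exp u))) := by
    refine MeasureTheory.tendsto_integral_filter_of_dominated_convergence
      (fun u => Real.exp ((1 + α) * u) * Real.exp (-Real.exp u) * (1 / Real.sin (π * α) ^ 2))
      (Eventually.of_forall fun y => Measurable.aestronglyMeasurable (by fun_prop)) ?_
      ((integrable_exp_mul_exp_neg_exp h1α).mul_const _) (ae_of_all _ fun u => ?_)
    · filter_upwards [Ioi_mem_atTop 0] with y hy
      have hy : 0 < y := hy
      refine ae_of_all _ fun u => ?_
      have hle := sq_mul_sin_sq_le α (Real.exp (α * u)) y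
      have hpos : 0 < y ^ 2 * Real.sin (π * α) ^ 2 := by positivity
      have hN := hpos.trans_le hle
      rw [Real.norm_of_nonneg (by positivity)]
      refine mul_le_mul_of_nonneg_left ?_ (by positivity)
      rw [div_le_div_iff₀ hN (by positivity)]
      linarith
    · have hinv := tendsto_inv_atTop_zero (𝕜 := ℝ)
      have hden : Tendsto (fun y : ℝ => (Real.exp (α * u) * y⁻¹) ^ 2 +
          2 * (Real.exp (α * u) * y⁻¹) * Real.cos (π * α) + 1) atTop
          (𝓝 ((Real.exp (α * u) * 0) ^ 2 +
            2 * (Real.exp (α * u) * 0) * Real.cos (π * α) + 1)) := by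
        have h := hinv.const_mul (Real.exp (α * u))
        exact ((h.pow 2).add ((h.const_mul 2).mul_const _)).add_const 1
      have hlim := (hden.inv₀ (by simp)).const_mul
        (Real.exp ((1 + α) * u) * Real.exp (-Real.exp u))
      have h1 : ((Real.exp (α * u) * 0) ^ 2 +
            2 * (Real.exp (α * u) * 0) * Real.cos (π * α) + 1)⁻¹ = 1 := by simp
      rw [h1, mul_one] at hlim
      refine hlim.congr' ?_
      filter_upwards [Ioi_mem_atTop 0] with y hy
      have hy0 : y ≠ 0 := (mem_Ioi.1 hy).ne'
      congr 1
      rw [← one_div, eq_comm, ← div_div_div_cancel_right₀ (pow_ne_zero 2 hy0),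
        div_self (by positivity)]
      congr 1
      field_simp
  have hlim := hint.const_mul (Real.sin (π * α) / π)
  rw [integral_exp_mul_exp_neg_exp h1α] at hlim
  have hval : Real.sin (π * α) / π * Real.Gamma (1 + α) = -1 / Real.Gamma (-α) := by
    have hr := Real.Gamma_mul_Gamma_one_sub (-α)
    rw [sub_neg_eq_add, mul_neg, Real.sin_neg] at hr
    have hpi := Real.pi_pos
    have hne : Real.Gamma (-α) ≠ 0 := by
      intro h0
      rw [h0, zero_mul, eq_comm, div_eq_zero_iff] at hr
      rcases hr with h | h <;> linarith
    rw [eq_div_iff hne, div_mul_eq_mul_div, div_mul_eq_mul_div, div_eq_iff hpi.ne']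
    rw [eq_div_iff (by linarith)] at hr
    linarith
  rw [hval] at hlim
  refine hlim.congr' ?_
  filter_upwards [Ioi_mem_atTop 0] with y hy
  rw [mlE_neg_eq_integral hα hα1 hy, mul_left_comm, ← integral_const_mul (y ^ 2)]
  congr 2
  funext u
  ring

theorem stmt_18
    (α lam γ : ℝ) (hα : 0 < α) (hα1 : α < 1) (hlam : 0 < lam) (hγ : 0 < γ) :
    Tendsto
        (fun t : ℝ => Real.exp ((1 + α) * γ * t) *
          (Real.exp (γ * t) ^ (α - 1) * mlE α α (-(lam * Real.exp (γ * t) ^ α)))) atTop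
        (nhds (-1 / (lam ^ 2 * Real.Gamma (-α)))) ∧
      (fun t : ℝ => Real.exp (γ * t) ^ (α - 1) * mlE α α (-(lam * Real.exp (γ * t) ^ α)))
        =O[atTop] fun t : ℝ => Real.exp (-(1 + α) * γ * t) := by
  have hy : Tendsto (fun t : ℝ => lam * Real.exp (γ * t) ^ α) atTop atTop :=
    ((tendsto_rpow_atTop hα).comp
      (Real.tendsto_exp_atTop.comp (tendsto_id.const_mul_atTop hγ))).const_mul_atTop hlam
  have hmain : Tendsto
      (fun t : ℝ => Real.exp ((1 + α) * γ * t) *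
        (Real.exp (γ * t) ^ (α - 1) * mlE α α (-(lam * Real.exp (γ * t) ^ α)))) atTop
      (nhds (-1 / (lam ^ 2 * Real.Gamma (-α)))) := by
    have h := ((tendsto_sq_mul_mlE_neg hα hα1).comp hy).const_mul (1 / lam ^ 2)
    have hval : 1 / lam ^ 2 * (-1 / Real.Gamma (-α)) = -1 / (lam ^ 2 * Real.Gamma (-α)) := by
      rw [div_mul_div_comm, one_mul]
    rw [hval] at h
    refine h.congr fun t => ?_
    have hexp : Real.exp ((1 + α) * γ * t) * Real.exp (γ * t) ^ (α - 1) =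
        (Real.exp (γ * t) ^ α) ^ 2 := by
      rw [← Real.exp_mul, ← Real.exp_mul, ← Real.exp_add, ← Real.exp_nat_mul]
      congr 1
      push_cast
      ring
    rw [← mul_assoc, hexp]
    simp only [Function.comp_apply]
    field_simp
  refine ⟨hmain, ?_⟩
  have hO := (Asymptotics.isBigO_refl (fun t : ℝ => Real.exp (-(1 + α) * γ * t)) atTop).mul
    (hmain.isBigO_one ℝ)
  refine (hO.congr_left fun t => ?_).congr_right fun t => mul_one _
  rw [← mul_assoc, ← Real.exp_add]
  have : -(1 + α) * γ * t + (1 + α) * γ * t = 0 := by ring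
  rw [this, Real.exp_zero, one_mul]
end
end

section
/- Let 0 < α < 1 and let f ∈ L¹_{ψ,ω}(ℝ) be such that the weighted Weyl integral g := 𝔍^α_{ψ,ω} f, defined by g(t) = (1/(Γ(α) ω(t))) ∫_{-∞}^t (ψ(t) − ψ(τ))^{α−1} ω(τ) f(τ) ψ'(τ) dτ, also belongs to L¹_{ψ,ω}(ℝ). Then the weighted Weyl derivative is a left inverse of the weighted Weyl integral: for almost every t ∈ ℝ, (1/(ω(t) ψ'(t))) · d/dt [ ∫_{-∞}^t ((ψ(t) − ψ(τ))^{−α} / Γ(1−α)) ω(τ) g(τ) ψ'(τ) dτ ] = f(t). -/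
open MeasureTheory Set Filter

noncomputable section

theorem integral_rpow_mul_one_sub_rpow_neg {α : ℝ} (hα : 0 < α) (hα1 : α < 1) :
    ∫ x in Ioo (0 : ℝ) 1, x ^ (α - 1) * (1 - x) ^ (-α) =
      Real.Gamma α * Real.Gamma (1 - α) := by
  have h := Complex.betaIntegral_eq_Gamma_mul_div (α : ℂ) ((1 - α : ℝ) : ℂ)
    (by simpa using hα) (by simpa using hα1)
  have hsum : (α : ℂ) + ((1 - α : ℝ) : ℂ) = 1 := by push_cast; ring
  rw [hsum, Complex.Gamma_one, div_one, Complex.Gamma_ofReal, Complex.Gamma_ofReal,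
    Complex.betaIntegral, intervalIntegral.integral_of_le zero_le_one,
    integral_Ioc_eq_integral_Ioo] at h
  have h' : ((∫ x in Ioo (0 : ℝ) 1, x ^ (α - 1) * (1 - x) ^ (-α) : ℝ) : ℂ) =
      Real.Gamma α * Real.Gamma (1 - α) := by
    rw [← h, ← integral_complex_ofReal]
    refine setIntegral_congr_fun measurableSet_Ioo fun x hx => ?_
    simp only [Complex.ofReal_mul]
    rw [Complex.ofReal_cpow hx.1.le, Complex.ofReal_cpow (sub_nonneg.2 hx.2.le)]
    push_cast
    ring_nf
  exact_mod_cast h'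

/-- The kernel obtained by composing the Weyl integral of order `α` with the one of order `1 - α`,
with evaluation point `s`. -/
def weylKernel (ψ ψ' : ℝ → ℝ) (α s τ σ : ℝ) : ℝ :=
  if σ < τ ∧ τ < s then (ψ s - ψ τ) ^ (-α) * (ψ τ - ψ σ) ^ (α - 1) * ψ' τ else 0

section weylKernel

variable {ψ ψ' : ℝ → ℝ} {α : ℝ}

theorem measurable_weylKernel (hψ : Measurable ψ) (hψ' : Measurable ψ') (s : ℝ) :
    Measurable fun p : ℝ × ℝ => weylKernel ψ ψ' α s p.1 p.2 := by
  unfold weylKernel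
  refine Measurable.ite ?_ (by fun_prop) measurable_const
  exact (measurableSet_lt measurable_snd measurable_fst).inter
    (measurableSet_lt measurable_fst measurable_const)

theorem weylKernel_nonneg (hψ : StrictMono ψ) (hψ'pos : ∀ t, 0 < ψ' t) (s τ σ : ℝ) :
    0 ≤ weylKernel ψ ψ' α s τ σ := by
  unfold weylKernel
  split_ifs with h
  · exact mul_nonneg (mul_nonneg (Real.rpow_nonneg (sub_nonneg.2 (hψ h.2).le) _)
      (Real.rpow_nonneg (sub_nonneg.2 (hψ h.1).le) _)) (hψ'pos τ).le
  · exact le_rfl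

theorem integral_weylKernel_of_lt (hψ : StrictMono ψ) (hψderiv : ∀ t, HasDerivAt ψ (ψ' t) t)
    (hψ'pos : ∀ t, 0 < ψ' t) (hα : 0 < α) (hα1 : α < 1) {s σ : ℝ} (h : σ < s) :
    ∫ τ, weylKernel ψ ψ' α s τ σ = Real.Gamma α * Real.Gamma (1 - α) := by
  have hL : 0 < ψ s - ψ σ := sub_pos.2 (hψ h)
  set L := ψ s - ψ σ with hLdef
  set φ : ℝ → ℝ := fun τ => (ψ τ - ψ σ) / L with hφ
  have hφmono : StrictMono φ := fun a b hab =>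
    div_lt_div_of_pos_right (sub_lt_sub_right (hψ hab) _) hL
  have hφderiv (t : ℝ) : HasDerivAt φ (ψ' t / L) t := ((hψderiv t).sub_const _).div_const _
  have hφσ : φ σ = 0 := by simp [hφ]
  have hφs : φ s = 1 := by simp only [hφ]; exact div_self hL.ne'
  have himage : φ '' Ioo σ s = Ioo 0 1 := by
    rw [← hφσ, ← hφs]
    refine Subset.antisymm ?_ (intermediate_value_Ioo h.le
      fun t _ => (hφderiv t).continuousAt.continuousWithinAt)
    rintro _ ⟨t, ht, rfl⟩
    exact ⟨hφmono ht.1, hφmono ht.2⟩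
  rw [← integral_rpow_mul_one_sub_rpow_neg hα hα1, ← himage,
    integral_image_eq_integral_abs_deriv_smul measurableSet_Ioo
      (fun t _ => (hφderiv t).hasDerivWithinAt) hφmono.injective.injOn,
    ← integral_indicator measurableSet_Ioo]
  congr 1
  ext τ
  by_cases hτ : τ ∈ Ioo σ s
  · have hpos : 0 < ψ τ - ψ σ := sub_pos.2 (hψ hτ.1)
    have hpos' : 0 < ψ s - ψ τ := sub_pos.2 (hψ hτ.2)
    have hsub : 1 - φ τ = (ψ s - ψ τ) / L := by
      rw [eq_div_iff hL.ne', sub_mul, one_mul, div_mul_cancel₀ _ hL.ne', hLdef]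
      ring
    have hpow : L ^ (α - 1) * L ^ (-α) = L⁻¹ := by
      rw [← Real.rpow_add hL, ← Real.rpow_neg_one]
      ring_nf
    rw [indicator_of_mem hτ, weylKernel, if_pos (mem_Ioo.1 hτ), hsub, abs_of_pos (div_pos (hψ'pos τ) hL),
      Real.div_rpow hpos.le hL.le, Real.div_rpow hpos'.le hL.le, smul_eq_mul, div_mul_div_comm,
      hpow]
    field_simp
  · rw [indicator_of_notMem hτ, weylKernel, if_neg (mt mem_Ioo.2 hτ)]

theorem weylKernel_eq_zero_of_le {s σ : ℝ} (h : s ≤ σ) (τ : ℝ) :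
    weylKernel ψ ψ' α s τ σ = 0 :=
  if_neg fun hτ => (hτ.1.trans hτ.2).not_ge h

theorem integral_weylKernel (hψ : StrictMono ψ) (hψderiv : ∀ t, HasDerivAt ψ (ψ' t) t)
    (hψ'pos : ∀ t, 0 < ψ' t) (hα : 0 < α) (hα1 : α < 1) (s σ : ℝ) :
    ∫ τ, weylKernel ψ ψ' α s τ σ =
      (Iio s).indicator (fun _ => Real.Gamma α * Real.Gamma (1 - α)) σ := by
  by_cases h : σ < s
  · rw [integral_weylKernel_of_lt hψ hψderiv hψ'pos hα hα1 h, indicator_of_mem (mem_Iio.2 h)]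
  · simp [weylKernel_eq_zero_of_le (not_lt.1 h), h]

theorem integrable_weylKernel (hψ : StrictMono ψ) (hψderiv : ∀ t, HasDerivAt ψ (ψ' t) t)
    (hψ'pos : ∀ t, 0 < ψ' t) (hα : 0 < α) (hα1 : α < 1) (s σ : ℝ) :
    Integrable fun τ => weylKernel ψ ψ' α s τ σ := by
  by_cases h : σ < s
  · refine Integrable.of_integral_ne_zero ?_
    rw [integral_weylKernel_of_lt hψ hψderiv hψ'pos hα hα1 h]
    exact (mul_pos (Real.Gamma_pos_of_pos hα) (Real.Gamma_pos_of_pos (sub_pos.2 hα1))).ne'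
  · simp [weylKernel_eq_zero_of_le (not_lt.1 h)]

theorem integrable_weylKernel_mul (hψ : StrictMono ψ) (hψderiv : ∀ t, HasDerivAt ψ (ψ' t) t)
    (hψ' : Measurable ψ') (hψ'pos : ∀ t, 0 < ψ' t) (hα : 0 < α) (hα1 : α < 1)
    {h : ℝ → ℂ} (hh : Integrable h) (s : ℝ) :
    Integrable (fun p : ℝ × ℝ => (weylKernel ψ ψ' α s p.1 p.2 : ℂ) * h p.2)
      (volume.prod volume) := by
  have hmeas : Measurable fun p : ℝ × ℝ => (weylKernel ψ ψ' α s p.1 p.2 : ℂ) :=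
    Complex.measurable_ofReal.comp (measurable_weylKernel hψ.monotone.measurable hψ' s)
  refine (integrable_prod_iff' (hmeas.aestronglyMeasurable.mul hh.1.comp_snd)).2
    ⟨ae_of_all _ fun σ =>
      (integrable_weylKernel hψ hψderiv hψ'pos hα hα1 s σ).ofReal.mul_const (h σ), ?_⟩
  have hnorm (σ : ℝ) : ∫ τ, ‖(weylKernel ψ ψ' α s τ σ : ℂ) * h σ‖ =
      (Iio s).indicator (fun σ => Real.Gamma α * Real.Gamma (1 - α) * ‖h σ‖) σ := by
    simp_rw [norm_mul, Complex.norm_real,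
      Real.norm_of_nonneg (weylKernel_nonneg hψ hψ'pos s _ σ)]
    rw [integral_mul_const, integral_weylKernel hψ hψderiv hψ'pos hα hα1]
    by_cases hσ : σ < s <;> simp [hσ]
  exact ((hh.norm.const_mul _).indicator measurableSet_Iio).congr
    (ae_of_all _ fun σ => (hnorm σ).symm)

theorem integral_integral_weylKernel_mul (hψ : StrictMono ψ)
    (hψderiv : ∀ t, HasDerivAt ψ (ψ' t) t)
    (hψ' : Measurable ψ') (hψ'pos : ∀ t, 0 < ψ' t) (hα : 0 < α) (hα1 : α < 1)
    {h : ℝ → ℂ} (hh : Integrable h) (s : ℝ) :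
    ∫ τ, ∫ σ, (weylKernel ψ ψ' α s τ σ : ℂ) * h σ =
      ((Real.Gamma α * Real.Gamma (1 - α) : ℝ) : ℂ) * ∫ σ in Iio s, h σ := by
  rw [integral_integral_swap
      (integrable_weylKernel_mul hψ hψderiv hψ' hψ'pos hα hα1 hh s),
    ← integral_const_mul, ← integral_indicator measurableSet_Iio]
  congr 1
  ext σ
  rw [integral_mul_const, integral_complex_ofReal,
    integral_weylKernel hψ hψderiv hψ'pos hα hα1]
  by_cases hσ : σ < s <;> simp [hσ]

end weylKernel

theorem MeasureTheory.Integrable.ae_hasDerivAt_integral_Iio {h : ℝ → ℂ} (hh : Integrable h) :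
    ∀ᵐ t : ℝ, HasDerivAt (fun s => ∫ σ in Iio s, h σ) (h t) t := by
  filter_upwards [LocallyIntegrable.ae_hasDerivAt_integral hh.locallyIntegrable] with t ht
  have hsplit : (fun s => ∫ σ in Iio s, h σ) =
      fun s => (∫ σ in (0 : ℝ)..s, h σ) + ∫ σ in Iic 0, h σ := by
    ext s
    rw [← integral_Iic_eq_integral_Iio,
      ← intervalIntegral.integral_Iic_sub_Iic hh.integrableOn hh.integrableOn]
    ring
  rw [hsplit]
  exact (ht 0).add_const _

theorem stmt_19
    (ψ ψ' ω : ℝ → ℝ)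
    (hψmono : StrictMono ψ)
    (hψderiv : ∀ t, HasDerivAt ψ (ψ' t) t)
    (hψ'cont : Continuous ψ')
    (hψ'pos : ∀ t, 0 < ψ' t)
    (hψtop : Tendsto ψ atTop atTop)
    (hψbot : Tendsto ψ atBot atBot)
    (hωmeas : Measurable ω)
    (hωpos : ∀ t, 0 < ω t)
    (hωloc : ∀ K : Set ℝ, IsCompact K → ∃ C > 0, ∀ t ∈ K, ω t ≤ C ∧ C⁻¹ ≤ ω t)
    (α : ℝ) (hα : 0 < α) (hα1 : α < 1)
    (f g : ℝ → ℂ)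
    (hf : Integrable (fun t : ℝ => ((ω t * ψ' t : ℝ) : ℂ) * f t))
    (hgdef : ∀ t : ℝ, g t = ((Real.Gamma α * ω t : ℝ) : ℂ)⁻¹ *
      ∫ τ in Set.Iio t, (((ψ t - ψ τ) ^ (α - 1) * (ω τ * ψ' τ) : ℝ) : ℂ) * f τ)
    (hg : Integrable (fun t : ℝ => ((ω t * ψ' t : ℝ) : ℂ) * g t)) :
    ∀ᵐ t : ℝ,
      HasDerivAt
        (fun s : ℝ => ∫ τ in Set.Iio s,
          (((ψ s - ψ τ) ^ (-α) / Real.Gamma (1 - α) * (ω τ * ψ' τ) : ℝ) : ℂ) * g τ)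
        (((ω t * ψ' t : ℝ) : ℂ) * f t) t := by
  have hΓ : (Real.Gamma α : ℂ) ≠ 0 := by exact_mod_cast (Real.Gamma_pos_of_pos hα).ne'
  have hΓ' : (Real.Gamma (1 - α) : ℂ) ≠ 0 := by
    exact_mod_cast (Real.Gamma_pos_of_pos (sub_pos.2 hα1)).ne'
  have hprim : (fun s : ℝ => ∫ τ in Set.Iio s,
      (((ψ s - ψ τ) ^ (-α) / Real.Gamma (1 - α) * (ω τ * ψ' τ) : ℝ) : ℂ) * g τ) =
      fun s => ∫ σ in Iio s, ((ω σ * ψ' σ : ℝ) : ℂ) * f σ := by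
    ext s
    have hcomp := integral_integral_weylKernel_mul hψmono hψderiv hψ'cont.measurable hψ'pos
      hα hα1 hf s
    rw [← mul_right_inj' (mul_ne_zero hΓ hΓ'), ← Complex.ofReal_mul, ← hcomp,
      ← integral_const_mul, ← integral_indicator measurableSet_Iio]
    congr 1
    ext τ
    by_cases hτ : τ < s
    · have hω : (ω τ : ℂ) ≠ 0 := by exact_mod_cast (hωpos τ).ne'
      have hinner : ∫ σ, (weylKernel ψ ψ' α s τ σ : ℂ) * (((ω σ * ψ' σ : ℝ) : ℂ) * f σ) =
          (((ψ s - ψ τ) ^ (-α) * ψ' τ : ℝ) : ℂ) * ∫ σ in Iio τ,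
            (((ψ τ - ψ σ) ^ (α - 1) * (ω σ * ψ' σ) : ℝ) : ℂ) * f σ := by
        rw [← integral_const_mul, ← integral_indicator measurableSet_Iio]
        congr 1
        ext σ
        by_cases hσ : σ < τ
        · rw [indicator_of_mem (mem_Iio.2 hσ), weylKernel, if_pos ⟨hσ, hτ⟩]
          push_cast
          ring
        · rw [indicator_of_notMem (by simpa using hσ), weylKernel, if_neg fun h => hσ h.1]
          simp
      rw [indicator_of_mem (mem_Iio.2 hτ), hinner, hgdef]
      push_cast
      field_simp
    · rw [indicator_of_notMem (by simpa using hτ)]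
      simp [weylKernel, hτ]
  rw [hprim]
  exact hf.ae_hasDerivAt_integral_Iio
end
end
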